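/- arXiv:2503.03007 — 3 statements merged into one kernel-verified Lean document; each statement's English description precedes it below -/
import Mathlib

section
/- Exactness of Tweedie's formula for the denoising mean: Let μ be a probability measure on ℝ^D with finite first moment (∫ ‖m‖ dμ < ∞), and let σ > 0. Define the Gaussian density φ_σ(x) := (2πσ²)^{−D/2} exp(−‖x‖²/(2σ²)) and the noised density p(x) := ∫ φ_σ(x − m) dμ(m). Then p(x) > 0 for every x, the function log ∘ p is differentiable, and for every x the conditional mean of the clean variable given the noised value x satisfies E[m₀ ∣ m_t = x] := (p(x))⁻¹ • ∫ m • φ_σ(x − m) dμ(m) = x + σ² • ∇(log p)(x). -/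
open MeasureTheory Real

/-- Differentiation under the integral sign, in gradient form. -/
theorem hasGradientAt_integral_of_dominated {α E : Type*} [MeasurableSpace α]
    [NormedAddCommGroup E] [InnerProductSpace ℝ E] [CompleteSpace E] {μ : Measure α}
    {F : E → α → ℝ} {G : E → α → E} {bound : α → ℝ} {x₀ : E} {s : Set E} (hs : s ∈ nhds x₀)
    (hF_meas : ∀ᶠ x in nhds x₀, AEStronglyMeasurable (F x) μ) (hF_int : Integrable (F x₀) μ)
    (hG_int : Integrable (G x₀) μ) (h_bound : ∀ᵐ a ∂μ, ∀ x ∈ s, ‖G x a‖ ≤ bound a)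
    (bound_integrable : Integrable bound μ)
    (h_diff : ∀ᵐ a ∂μ, ∀ x ∈ s, HasGradientAt (F · a) (G x a) x) :
    HasGradientAt (fun x ↦ ∫ a, F x a ∂μ) (∫ a, G x₀ a ∂μ) x₀ := by
  have h_meas : AEStronglyMeasurable (fun a ↦ InnerProductSpace.toDual ℝ E (G x₀ a)) μ :=
    (InnerProductSpace.toDual ℝ E).continuous.comp_aestronglyMeasurable
      hG_int.aestronglyMeasurable
  have h_int : Integrable (fun a ↦ InnerProductSpace.toDual ℝ E (G x₀ a)) μ :=
    hG_int.congr' h_meas (.of_forall fun a ↦ by simp)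
  have h := hasFDerivAt_integral_of_dominated_of_fderiv_le
    (F' := fun x a ↦ InnerProductSpace.toDual ℝ E (G x a)) hs hF_meas hF_int h_meas
    (by simpa using h_bound) bound_integrable
    (h_diff.mono fun a ha x hx ↦ (ha x hx).hasFDerivAt)
  rw [hasGradientAt_iff_hasFDerivAt]
  refine h.congr_fderiv ?_
  ext w
  rw [ContinuousLinearMap.integral_apply h_int]
  simp only [InnerProductSpace.toDual_apply_apply]
  simp only [real_inner_comm w]
  exact integral_inner hG_int w

theorem hasGradientAt_const_mul_exp_neg_norm_sq {E : Type*} [NormedAddCommGroup E]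
    [InnerProductSpace ℝ E] [CompleteSpace E] (C s : ℝ) (m x : E) :
    HasGradientAt (fun x ↦ C * exp (-‖x - m‖ ^ 2 / (2 * s)))
      ((C * exp (-‖x - m‖ ^ 2 / (2 * s)) * s⁻¹) • (m - x)) x := by
  rw [hasGradientAt_iff_hasFDerivAt]
  have h := ((((((hasFDerivAt_id (𝕜 := ℝ) x).sub_const m).norm_sq).neg).mul_const
    (2 * s)⁻¹).exp).const_mul C
  simp only [← div_eq_mul_inv] at h
  refine h.congr_fderiv ?_
  ext w
  simp only [InnerProductSpace.toDual_apply_apply, inner_smul_left, inner_sub_left,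
    id, smul_eq_mul, smul_apply, neg_apply,
    ContinuousLinearMap.comp_apply, innerSL_apply_apply, mul_inv, conj_trivial,
    ContinuousLinearMap.id_apply]
  simp
  ring

/-- Exactness of Tweedie's formula for the denoising mean: for a prior `μ` with finite
first moment and noise level `σ > 0`, the noised density `p` is everywhere positive,
`log ∘ p` is differentiable, and the conditional mean of the clean variable given the
noised value `x` equals `x + σ² ∇(log p)(x)`. -/
theorem tweedie_formula_first_order (D : ℕ) (hD : 0 < D)
    (μ : Measure (EuclideanSpace ℝ (Fin D))) [IsProbabilityMeasure μ]
    (hμ : Integrable (fun m => ‖m‖) μ)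
    (σ : ℝ) (hσ : 0 < σ)
    (φ : EuclideanSpace ℝ (Fin D) → ℝ)
    (hφ : φ = fun x => (2 * π * σ ^ 2) ^ (-(D : ℝ) / 2) * Real.exp (-‖x‖ ^ 2 / (2 * σ ^ 2)))
    (p : EuclideanSpace ℝ (Fin D) → ℝ)
    (hp : p = fun x => ∫ m, φ (x - m) ∂μ) :
    (∀ x, 0 < p x) ∧
    Differentiable ℝ (fun x => Real.log (p x)) ∧
    ∀ x, (p x)⁻¹ • (∫ m, φ (x - m) • m ∂μ)
        = x + σ ^ 2 • gradient (fun x => Real.log (p x)) x := by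
  set C : ℝ := (2 * π * σ ^ 2) ^ (-(D : ℝ) / 2)
  have hC_pos : 0 < C := by positivity
  have hφ_pos : ∀ x, 0 < φ x := fun x ↦ by rw [hφ]; positivity
  have hφ_le : ∀ x, φ x ≤ C := fun x ↦ by
    rw [hφ]
    refine mul_le_of_le_one_right hC_pos.le (exp_le_one_iff.2 ?_)
    exact div_nonpos_of_nonpos_of_nonneg (by simp) (by positivity)
  have hφ_norm : ∀ x, ‖φ x‖ ≤ C := fun x ↦ by
    rw [norm_of_nonneg (hφ_pos x).le]; exact hφ_le x
  have hφ_cont : Continuous φ := by rw [hφ]; fun_prop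
  have hφ_meas : ∀ x, AEStronglyMeasurable (fun m ↦ φ (x - m)) μ := fun x ↦
    (hφ_cont.comp (continuous_const.sub continuous_id)).aestronglyMeasurable
  have hφ_int : ∀ x, Integrable (fun m ↦ φ (x - m)) μ := fun x ↦
    .of_bound (hφ_meas x) C (.of_forall fun m ↦ hφ_norm _)
  have h_id : Integrable (fun m : EuclideanSpace ℝ (Fin D) ↦ m) μ :=
    (integrable_norm_iff aestronglyMeasurable_id).1 hμ
  have hφ_smul : ∀ x, Integrable (fun m ↦ φ (x - m) • m) μ := fun x ↦
    h_id.bdd_smul C (hφ_meas x) (.of_forall fun m ↦ hφ_norm _)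
  have hp_pos : ∀ x, 0 < p x := fun x ↦ by
    rw [hp]
    refine (integral_pos_iff_support_of_nonneg (fun m ↦ (hφ_pos _).le) (hφ_int x)).2 ?_
    rw [Function.support_eq_univ fun m ↦ (hφ_pos (x - m)).ne']
    simp
  have h_eq : ∀ x m, (φ (x - m) * (σ ^ 2)⁻¹) • (m - x)
      = (σ ^ 2)⁻¹ • (φ (x - m) • m - φ (x - m) • x) := fun x m ↦ by
    rw [mul_comm, mul_smul, smul_sub]
  have hp_grad : ∀ x, HasGradientAt p
      ((σ ^ 2)⁻¹ • ((∫ m, φ (x - m) • m ∂μ) - p x • x)) x := fun x ↦ by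
    have h := hasGradientAt_integral_of_dominated (μ := μ) (F := fun x m ↦ φ (x - m))
      (G := fun x m ↦ (φ (x - m) * (σ ^ 2)⁻¹) • (m - x))
      (bound := fun m ↦ C * (σ ^ 2)⁻¹ * (‖m‖ + (‖x‖ + 1)))
      (Metric.ball_mem_nhds x one_pos) (.of_forall hφ_meas) (hφ_int x)
      (by
        simp only [h_eq]
        exact ((hφ_smul x).sub ((hφ_int x).smul_const x)).smul (σ ^ 2)⁻¹)
      (.of_forall fun m y hy ↦ by
        rw [norm_smul, norm_mul, norm_of_nonneg (by positivity : 0 ≤ (σ ^ 2)⁻¹)]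
        have hy' : ‖y‖ ≤ ‖x‖ + 1 := by
          have := norm_le_norm_add_norm_sub' y x
          rw [mem_ball_iff_norm] at hy
          linarith
        gcongr
        · exact hφ_norm _
        · exact (norm_sub_le m y).trans (by gcongr))
      ((hμ.add (integrable_const _)).const_mul _)
      (.of_forall fun m y _ ↦ by
        rw [hφ]
        exact hasGradientAt_const_mul_exp_neg_norm_sq C (σ ^ 2) m y)
    simp only [h_eq] at h
    rw [integral_smul, integral_sub (hφ_smul x) ((hφ_int x).smul_const x),
      integral_smul_const] at h
    rw [hp]
    exact h
  have hlog : ∀ x, HasGradientAt (fun x ↦ log (p x))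
      ((p x)⁻¹ • (σ ^ 2)⁻¹ • ((∫ m, φ (x - m) • m ∂μ) - p x • x)) x := fun x ↦ by
    rw [hasGradientAt_iff_hasFDerivAt]
    refine ((hp_grad x).hasFDerivAt.log (hp_pos x).ne').congr_fderiv ?_
    simp
  refine ⟨hp_pos, fun x ↦ (hlog x).differentiableAt, fun x ↦ ?_⟩
  have hp0 := (hp_pos x).ne'
  rw [(hlog x).gradient, smul_comm (p x)⁻¹, smul_inv_smul₀ (by positivity), smul_sub,
    inv_smul_smul₀ hp0, add_sub_cancel]
end

section
/- Exactness of the generalized (second-order) Tweedie formula for the denoising covariance: Let μ be a probability measure on ℝ^D with finite second moment (∫ ‖m‖² dμ < ∞), and let σ > 0. With φ_σ, p, and the conditional mean m̄(x) := (p(x))⁻¹ • ∫ m • φ_σ(x − m) dμ(m) as below, the function log ∘ p is twice differentiable, and for every x and all vectors u, v the conditional covariance satisfies (p(x))⁻¹ ∫ ⟪u, m − m̄(x)⟫ ⟪v, m − m̄(x)⟫ φ_σ(x − m) dμ(m) = σ² ⟪u, v⟫ + σ⁴ · (D² (log p)(x))(u, v), where D²(log p)(x) denotes the second derivative (Hessian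 bilinear form) of log p at x. Equivalently, Cov[m₀ ∣ m_t = x] = σ² ( I + σ² ∇² log p(x) ). -/
open MeasureTheory Real Filter Topology

open scoped RealInnerProductSpace

set_option maxSynthPendingDepth 3

section Translation

variable {E F : Type*} [NormedAddCommGroup E] [MeasurableSpace E] [BorelSpace E]
  [SecondCountableTopology E] [NormedAddCommGroup F] {μ : Measure E} [IsFiniteMeasure μ]

theorem integrable_comp_sub_left_of_bounded {f : E → F} (hf : Continuous f) {C : ℝ}
    (hC : ∀ y, ‖f y‖ ≤ C) (x : E) : Integrable (fun m => f (x - m)) μ :=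
  .of_bound (by fun_prop) C (.of_forall fun m => hC (x - m))

theorem continuous_integral_comp_sub_left_of_bounded [NormedSpace ℝ F] {f : E → F}
    (hf : Continuous f) {C : ℝ} (hC : ∀ y, ‖f y‖ ≤ C) :
    Continuous fun x => ∫ m, f (x - m) ∂μ :=
  continuous_of_dominated (fun _ => by fun_prop)
    (fun x => .of_forall fun m => hC (x - m)) (integrable_const C)
    (.of_forall fun m => by fun_prop)

theorem hasFDerivAt_integral_comp_sub_left_of_bounded [NormedSpace ℝ E] [NormedSpace ℝ F]
    {f : E → F} {f' : E → E →L[ℝ] F} (hf : ∀ y, HasFDerivAt f (f' y) y) (hf' : Continuous f')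
    {C C' : ℝ} (hC : ∀ y, ‖f y‖ ≤ C) (hC' : ∀ y, ‖f' y‖ ≤ C') (x : E) :
    HasFDerivAt (fun x => ∫ m, f (x - m) ∂μ) (∫ m, f' (x - m) ∂μ) x := by
  have hfc : Continuous f := continuous_iff_continuousAt.2 fun y => (hf y).continuousAt
  exact hasFDerivAt_integral_of_dominated_of_fderiv_le (bound := fun _ => C')
    (F := fun x m => f (x - m)) (F' := fun x m => f' (x - m)) univ_mem
    (.of_forall fun _ => by fun_prop) (integrable_comp_sub_left_of_bounded hfc hC x)
    (by fun_prop) (.of_forall fun m y _ => hC' (y - m)) (integrable_const C')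
    (.of_forall fun m y _ => by
      simpa [Function.comp_def] using (hf (y - m)).comp y ((hasFDerivAt_id y).sub_const m))

end Translation

section Gaussian

variable {E : Type*} [NormedAddCommGroup E]

/-- The Gaussian profile `y ↦ c * exp (-‖y‖² / (2 s))` with variance `s`. -/
noncomputable def gaussianProfile (c s : ℝ) (y : E) : ℝ := c * Real.exp (-‖y‖ ^ 2 / (2 * s))

theorem continuous_gaussianProfile (c s : ℝ) : Continuous (gaussianProfile c s : E → ℝ) := by
  unfold gaussianProfile; fun_prop

theorem gaussianProfile_nonneg {c : ℝ} (hc : 0 ≤ c) (s : ℝ) (y : E) :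
    0 ≤ gaussianProfile c s y := by
  unfold gaussianProfile; positivity

theorem gaussianProfile_le {c s : ℝ} (hc : 0 ≤ c) (hs : 0 ≤ s) (y : E) :
    gaussianProfile c s y ≤ c :=
  mul_le_of_le_one_right hc <| Real.exp_le_one_iff.2 <|
    div_nonpos_of_nonpos_of_nonneg (by simp) (by positivity)

theorem gaussianProfile_mul_norm_sq_le {c s : ℝ} (hc : 0 ≤ c) (hs : 0 < s) (y : E) :
    gaussianProfile c s y * ‖y‖ ^ 2 ≤ c * (2 * s) := by
  have h := (Real.mul_exp_neg_le_exp_neg_one (‖y‖ ^ 2 / (2 * s))).trans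
    (Real.exp_le_one_iff.2 (by norm_num : (-1 : ℝ) ≤ 0))
  rw [div_mul_eq_mul_div, div_le_one (by positivity)] at h
  rw [gaussianProfile, neg_div, mul_assoc, mul_comm (Real.exp _)]
  gcongr

theorem gaussianProfile_mul_norm_le {c s : ℝ} (hc : 0 ≤ c) (hs : 0 < s) (y : E) :
    gaussianProfile c s y * ‖y‖ ≤ c + c * (2 * s) := by
  have h0 := gaussianProfile_nonneg hc s y
  have h1 := gaussianProfile_le hc hs.le y
  have h2 := gaussianProfile_mul_norm_sq_le hc hs y
  nlinarith [mul_nonneg h0 (sq_nonneg (‖y‖ - 1)), mul_nonneg h0 (sq_nonneg ‖y‖)]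

section Measure

variable [MeasurableSpace E] [BorelSpace E] [SecondCountableTopology E]
  {μ : Measure E} [IsFiniteMeasure μ]

theorem integrable_gaussianProfile_sub {c s : ℝ} (hc : 0 ≤ c) (hs : 0 < s) (x : E) :
    Integrable (fun m => gaussianProfile c s (x - m)) μ :=
  integrable_comp_sub_left_of_bounded (continuous_gaussianProfile c s) (C := c) (fun y => by
    rw [Real.norm_of_nonneg (gaussianProfile_nonneg hc s y)]
    exact gaussianProfile_le hc hs.le y) x

theorem integral_gaussianProfile_pos [NeZero μ] {c s : ℝ} (hc : 0 < c) (hs : 0 < s) (x : E) :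
    0 < ∫ m, gaussianProfile c s (x - m) ∂μ := by
  have hpos (y : E) : 0 < gaussianProfile c s y := by unfold gaussianProfile; positivity
  rw [integral_pos_iff_support_of_nonneg (fun m => (hpos _).le)
      (integrable_gaussianProfile_sub hc.le hs x),
    Function.support_eq_univ fun m => (hpos _).ne']
  exact NeZero.pos _

end Measure

variable [InnerProductSpace ℝ E]

/-- The real inner product as a bilinear continuous map. -/
noncomputable def realInnerSL : E →L[ℝ] E →L[ℝ] ℝ := innerSL ℝ

@[simp]
theorem realInnerSL_apply (x y : E) : realInnerSL x y = ⟪x, y⟫ := rfl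

theorem norm_realInnerSL_apply (x : E) : ‖realInnerSL x‖ = ‖x‖ := innerSL_apply_norm ℝ x

/-- The first derivative of `gaussianProfile`. -/
noncomputable def gaussianProfileFDeriv (c s : ℝ) (y : E) : E →L[ℝ] ℝ :=
  (-(gaussianProfile c s y / s)) • realInnerSL y

/-- The second derivative of `gaussianProfile`. -/
noncomputable def gaussianProfileFDeriv₂ (c s : ℝ) (y : E) : E →L[ℝ] E →L[ℝ] ℝ :=
  (gaussianProfile c s y / s ^ 2) • (realInnerSL y).smulRight (realInnerSL y)
    - (gaussianProfile c s y / s) • realInnerSL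

theorem gaussianProfileFDeriv_apply (c s : ℝ) (y u : E) :
    gaussianProfileFDeriv c s y u = -(gaussianProfile c s y / s) * ⟪u, y⟫ := by
  simp [gaussianProfileFDeriv, real_inner_comm]

theorem gaussianProfileFDeriv₂_apply (c s : ℝ) (y u v : E) :
    gaussianProfileFDeriv₂ c s y u v =
      gaussianProfile c s y / s ^ 2 * (⟪u, y⟫ * ⟪v, y⟫) - gaussianProfile c s y / s * ⟪u, v⟫ := by
  simp [gaussianProfileFDeriv₂, real_inner_comm]

theorem hasFDerivAt_gaussianProfile (c s : ℝ) (y : E) :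
    HasFDerivAt (gaussianProfile c s) (gaussianProfileFDeriv c s y) y := by
  refine HasFDerivAt.congr_fderiv ((((hasStrictFDerivAt_norm_sq y).hasFDerivAt.fun_neg.mul_const
    (2 * s)⁻¹).exp.const_mul c).congr_of_eventuallyEq (.of_forall fun z => ?_)) ?_
  · simp [gaussianProfile, div_eq_mul_inv]
  · ext u
    simp [gaussianProfileFDeriv_apply, gaussianProfile, div_eq_mul_inv, real_inner_comm]
    ring

theorem hasFDerivAt_gaussianProfileFDeriv (c s : ℝ) (y : E) :
    HasFDerivAt (gaussianProfileFDeriv c s) (gaussianProfileFDeriv₂ c s y) y := by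
  have h : HasFDerivAt (fun z : E => realInnerSL z) realInnerSL y :=
    realInnerSL.hasFDerivAt
  refine (((hasFDerivAt_gaussianProfile c s y).mul_const s⁻¹).fun_neg.smul h).congr_fderiv ?_
  ext u v
  simp [gaussianProfileFDeriv₂_apply, gaussianProfileFDeriv_apply, real_inner_comm]
  ring

theorem continuous_gaussianProfileFDeriv (c s : ℝ) :
    Continuous (gaussianProfileFDeriv c s : E → E →L[ℝ] ℝ) :=
  continuous_iff_continuousAt.2 fun y => (hasFDerivAt_gaussianProfileFDeriv c s y).continuousAt

theorem continuous_gaussianProfileFDeriv₂ (c s : ℝ) :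
    Continuous (gaussianProfileFDeriv₂ c s : E → E →L[ℝ] E →L[ℝ] ℝ) := by
  have h := continuous_gaussianProfile (E := E) c s
  have h' : Continuous fun y : E =>
      (realInnerSL y).smulRight (realInnerSL y) :=
    ((ContinuousLinearMap.smulRightL ℝ E (E →L[ℝ] ℝ)).continuous.comp
      realInnerSL.continuous).clm_apply realInnerSL.continuous
  exact ((h.div_const _).smul h').sub ((h.div_const _).smul continuous_const)

theorem norm_gaussianProfileFDeriv_le {c s : ℝ} (hc : 0 ≤ c) (hs : 0 < s) (y : E) :
    ‖gaussianProfileFDeriv c s y‖ ≤ (c + c * (2 * s)) / s := by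
  have h0 := gaussianProfile_nonneg hc s y
  rw [gaussianProfileFDeriv, norm_smul, norm_neg, Real.norm_of_nonneg (by positivity),
    norm_realInnerSL_apply, div_mul_eq_mul_div]
  gcongr
  exact gaussianProfile_mul_norm_le hc hs y

theorem norm_gaussianProfileFDeriv₂_le {c s : ℝ} (hc : 0 ≤ c) (hs : 0 < s) (y : E) :
    ‖gaussianProfileFDeriv₂ c s y‖ ≤ c * (2 * s) / s ^ 2 + c / s := by
  have h0 := gaussianProfile_nonneg hc s y
  refine (norm_sub_le _ _).trans (add_le_add ?_ ?_)
  · rw [norm_smul, Real.norm_of_nonneg (by positivity), ContinuousLinearMap.norm_smulRight_apply,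
      norm_realInnerSL_apply, ← sq, div_mul_eq_mul_div]
    exact div_le_div_of_nonneg_right (gaussianProfile_mul_norm_sq_le hc hs y) (by positivity)
  · rw [norm_smul (_ / s) (realInnerSL (E := E)), Real.norm_of_nonneg (by positivity),
      ← mul_one (c / s)]
    gcongr
    · exact gaussianProfile_le hc hs.le y
    · exact norm_innerSL_le ℝ (E := E)

section Derivatives

variable [MeasurableSpace E] [BorelSpace E] [SecondCountableTopology E]
  {μ : Measure E} [IsFiniteMeasure μ] {c s : ℝ}

theorem integrable_gaussianProfile_smul_sub (hc : 0 ≤ c) (hs : 0 < s) (x : E) :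
    Integrable (fun m => gaussianProfile c s (x - m) • (x - m)) μ :=
  integrable_comp_sub_left_of_bounded (f := fun y : E => gaussianProfile c s y • y)
    ((continuous_gaussianProfile c s).smul continuous_id) (fun y => by
      rw [norm_smul, Real.norm_of_nonneg (gaussianProfile_nonneg hc s y)]
      exact gaussianProfile_mul_norm_le hc hs y) x

theorem integrable_gaussianProfileFDeriv_sub (hc : 0 ≤ c) (hs : 0 < s) (x : E) :
    Integrable (fun m => gaussianProfileFDeriv c s (x - m)) μ :=
  integrable_comp_sub_left_of_bounded (continuous_gaussianProfileFDeriv c s)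
    (norm_gaussianProfileFDeriv_le hc hs) x

theorem integrable_gaussianProfileFDeriv₂_sub (hc : 0 ≤ c) (hs : 0 < s) (x : E) :
    Integrable (fun m => gaussianProfileFDeriv₂ c s (x - m)) μ :=
  integrable_comp_sub_left_of_bounded (continuous_gaussianProfileFDeriv₂ c s)
    (norm_gaussianProfileFDeriv₂_le hc hs) x

theorem hasFDerivAt_integral_gaussianProfile (hc : 0 ≤ c) (hs : 0 < s) (x : E) :
    HasFDerivAt (fun x => ∫ m, gaussianProfile c s (x - m) ∂μ)
      (∫ m, gaussianProfileFDeriv c s (x - m) ∂μ) x :=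
  hasFDerivAt_integral_comp_sub_left_of_bounded (hasFDerivAt_gaussianProfile c s)
    (continuous_gaussianProfileFDeriv c s) (fun y => by
      rw [Real.norm_of_nonneg (gaussianProfile_nonneg hc s y)]
      exact gaussianProfile_le hc hs.le y)
    (norm_gaussianProfileFDeriv_le hc hs) x

theorem hasFDerivAt_integral_gaussianProfileFDeriv (hc : 0 ≤ c) (hs : 0 < s) (x : E) :
    HasFDerivAt (fun x => ∫ m, gaussianProfileFDeriv c s (x - m) ∂μ)
      (∫ m, gaussianProfileFDeriv₂ c s (x - m) ∂μ) x :=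
  hasFDerivAt_integral_comp_sub_left_of_bounded (hasFDerivAt_gaussianProfileFDeriv c s)
    (continuous_gaussianProfileFDeriv₂ c s) (norm_gaussianProfileFDeriv_le hc hs)
    (norm_gaussianProfileFDeriv₂_le hc hs) x

theorem contDiff_two_integral_gaussianProfile (hc : 0 ≤ c) (hs : 0 < s) :
    ContDiff ℝ 2 fun x : E => ∫ m, gaussianProfile c s (x - m) ∂μ := by
  refine contDiff_succ_iff_hasFDerivAt (n := 1).2
    ⟨_, contDiff_succ_iff_hasFDerivAt (n := 0).2 ⟨_, contDiff_zero.2 ?_,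
      hasFDerivAt_integral_gaussianProfileFDeriv hc hs⟩,
      hasFDerivAt_integral_gaussianProfile hc hs⟩
  exact continuous_integral_comp_sub_left_of_bounded (continuous_gaussianProfileFDeriv₂ c s)
    (norm_gaussianProfileFDeriv₂_le hc hs)

end Derivatives

end Gaussian

theorem fderiv_fderiv_log_apply {E : Type*} [NormedAddCommGroup E] [NormedSpace ℝ E] {f : E → ℝ}
    {f' : E → E →L[ℝ] ℝ} {f'' : E →L[ℝ] E →L[ℝ] ℝ} {x : E} (hpos : ∀ y, f y ≠ 0)
    (hf : ∀ y, HasFDerivAt f (f' y) y) (hf' : HasFDerivAt f' f'' x) (u v : E) :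
    fderiv ℝ (fderiv ℝ fun y => Real.log (f y)) x u v =
      (f x)⁻¹ * f'' u v - (f x)⁻¹ ^ 2 * (f' x u * f' x v) := by
  have h : (fderiv ℝ fun y => Real.log (f y)) = fun y => (f y)⁻¹ • f' y :=
    funext fun y => ((hf y).log (hpos y)).fderiv
  have hinv : HasFDerivAt (fun y => (f y)⁻¹) (-(f x ^ 2)⁻¹ • f' x) x :=
    (hasDerivAt_inv (hpos x)).comp_hasFDerivAt x (hf x)
  rw [h, (hinv.fun_smul hf').fderiv]
  simp
  ring



/-- Exactness of the generalized (second-order) Tweedie formula for the denoising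
covariance: for a prior `μ` with finite second moment and noise level `σ > 0`,
`log ∘ p` is twice differentiable and the conditional covariance of the clean variable
given the noised value `x` equals `σ² (I + σ² ∇² log p(x))`, expressed weakly against
all pairs of directions `u, v`. -/
theorem tweedie_formula_second_order (D : ℕ) (hD : 0 < D)
    (μ : Measure (EuclideanSpace ℝ (Fin D))) [IsProbabilityMeasure μ]
    (hμ : Integrable (fun m => ‖m‖ ^ 2) μ)
    (σ : ℝ) (hσ : 0 < σ)
    (φ : EuclideanSpace ℝ (Fin D) → ℝ)
    (hφ : φ = fun x => (2 * π * σ ^ 2) ^ (-(D : ℝ) / 2) * Real.exp (-‖x‖ ^ 2 / (2 * σ ^ 2)))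
    (p : EuclideanSpace ℝ (Fin D) → ℝ)
    (hp : p = fun x => ∫ m, φ (x - m) ∂μ)
    (mbar : EuclideanSpace ℝ (Fin D) → EuclideanSpace ℝ (Fin D))
    (hmbar : mbar = fun x => (p x)⁻¹ • (∫ m, φ (x - m) • m ∂μ)) :
    ContDiff ℝ 2 (fun x => Real.log (p x)) ∧
    ∀ x u v, (p x)⁻¹ * (∫ m, ⟪u, m - mbar x⟫ * ⟪v, m - mbar x⟫ * φ (x - m) ∂μ)
        = σ ^ 2 * ⟪u, v⟫
          + σ ^ 4 * (fderiv ℝ (fderiv ℝ (fun x => Real.log (p x))) x u v) := by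
  have hs : 0 < σ ^ 2 := by positivity
  set c : ℝ := (2 * π * σ ^ 2) ^ (-(D : ℝ) / 2)
  have hc : 0 < c := by positivity
  have hφ' : φ = gaussianProfile c (σ ^ 2) := hφ
  subst hφ'
  have hp0 (x) : 0 < p x := by
    rw [hp]; exact integral_gaussianProfile_pos hc hs x
  refine ⟨ContDiff.log (hp ▸ contDiff_two_integral_gaussianProfile hc.le hs)
    fun x => (hp0 x).ne', fun x u v => ?_⟩
  have hI := integrable_gaussianProfile_sub (μ := μ) hc.le hs x
  have hI₁ := integrable_gaussianProfile_smul_sub (μ := μ) hc.le hs x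
  have hI₂ := integrable_gaussianProfileFDeriv₂_sub (μ := μ) hc.le hs x
  have hI₂' : Integrable
      (fun m => gaussianProfile c (σ ^ 2) (x - m) * (⟪u, x - m⟫ * ⟪v, x - m⟫)) μ := by
    refine (((hI₂.apply_continuousLinearMap u).apply_continuousLinearMap v).add
      (hI.mul_const (⟪u, v⟫ / σ ^ 2))).const_mul ((σ ^ 2) ^ 2) |>.congr (.of_forall fun m => ?_)
    simp only [Pi.add_apply, gaussianProfileFDeriv₂_apply]
    field_simp
    ring
  have hpx : ∫ m, gaussianProfile c (σ ^ 2) (x - m) ∂μ = p x := by rw [hp]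
  have hJ (w) : Integrable (fun m => gaussianProfile c (σ ^ 2) (x - m) * ⟪w, x - m⟫) μ := by
    simpa only [inner_smul_right] using hI₁.const_inner (𝕜 := ℝ) w
  have hfirst (w) : ∫ m, gaussianProfile c (σ ^ 2) (x - m) * ⟪w, x - m⟫ ∂μ
      = p x * ⟪w, x - mbar x⟫ := by
    have h : ∫ m, gaussianProfile c (σ ^ 2) (x - m) • m ∂μ
        = p x • x - ∫ m, gaussianProfile c (σ ^ 2) (x - m) • (x - m) ∂μ := by
      rw [← hpx, ← integral_smul_const, ← integral_sub (hI.smul_const x) hI₁]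
      simp [smul_sub]
    have hx : p x • (x - mbar x) = ∫ m, gaussianProfile c (σ ^ 2) (x - m) • (x - m) ∂μ := by
      rw [hmbar]
      simp only [h, smul_sub, smul_inv_smul₀ (hp0 x).ne', sub_sub_cancel]
    rw [← inner_smul_right, hx, ← integral_inner hI₁]
    simp only [inner_smul_right]
  have hp' (w) : (∫ m, gaussianProfileFDeriv c (σ ^ 2) (x - m) ∂μ) w
      = -(p x * ⟪w, x - mbar x⟫) / σ ^ 2 := by
    rw [ContinuousLinearMap.integral_apply (integrable_gaussianProfileFDeriv_sub hc.le hs x),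
      ← hfirst, ← integral_neg, ← integral_div]
    congr with m
    rw [gaussianProfileFDeriv_apply]
    ring
  have hp'' : (∫ m, gaussianProfileFDeriv₂ c (σ ^ 2) (x - m) ∂μ) u v
      = (∫ m, gaussianProfile c (σ ^ 2) (x - m) * (⟪u, x - m⟫ * ⟪v, x - m⟫) ∂μ) / (σ ^ 2) ^ 2
        - p x * (⟪u, v⟫ / σ ^ 2) := by
    rw [ContinuousLinearMap.integral_apply hI₂,
      ContinuousLinearMap.integral_apply (hI₂.apply_continuousLinearMap u), ← hpx,
      ← integral_mul_const, ← integral_div, ← integral_sub (hI₂'.div_const _) (hI.mul_const _)]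
    congr with m
    rw [gaussianProfileFDeriv₂_apply]
    ring
  have hcov : ∫ m, ⟪u, m - mbar x⟫ * ⟪v, m - mbar x⟫ * gaussianProfile c (σ ^ 2) (x - m) ∂μ
      = ∫ m, gaussianProfile c (σ ^ 2) (x - m) * (⟪u, x - m⟫ * ⟪v, x - m⟫) ∂μ
        - p x * (⟪u, x - mbar x⟫ * ⟪v, x - mbar x⟫) := by
    have h (m) : ⟪u, m - mbar x⟫ * ⟪v, m - mbar x⟫ * gaussianProfile c (σ ^ 2) (x - m)
        = gaussianProfile c (σ ^ 2) (x - m) * (⟪u, x - m⟫ * ⟪v, x - m⟫)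
          - gaussianProfile c (σ ^ 2) (x - m) * ⟪u, x - m⟫ * ⟪v, x - mbar x⟫
          - gaussianProfile c (σ ^ 2) (x - m) * ⟪v, x - m⟫ * ⟪u, x - mbar x⟫
          + gaussianProfile c (σ ^ 2) (x - m) * (⟪u, x - mbar x⟫ * ⟪v, x - mbar x⟫) := by
      simp only [inner_sub_right]
      ring
    simp only [h]
    have hu := (hJ u).mul_const ⟪v, x - mbar x⟫
    have hv := (hJ v).mul_const ⟪u, x - mbar x⟫
    have huv : Integrable (fun m => gaussianProfile c (σ ^ 2) (x - m) * (⟪u, x - m⟫ * ⟪v, x - m⟫)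
        - gaussianProfile c (σ ^ 2) (x - m) * ⟪u, x - m⟫ * ⟪v, x - mbar x⟫) μ := hI₂'.sub hu
    rw [integral_add (by exact huv.sub hv) (hI.mul_const _), integral_sub huv hv,
      integral_sub hI₂' hu]
    simp only [integral_mul_const, hfirst, hpx]
    ring
  have hd := fderiv_fderiv_log_apply (f := p) (x := x) (fun y => (hp0 y).ne')
    (by rw [hp]; exact hasFDerivAt_integral_gaussianProfile hc.le hs)
    (hasFDerivAt_integral_gaussianProfileFDeriv (μ := μ) hc.le hs x) u v
  rw [hcov, hd, hp'', hp', hp']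
  have := (hp0 x).ne'
  field_simp
  ring
end

section
/- Exactness of randomize-then-optimize (RTO) sampling in the linear-Gaussian case: Let A be a real K×D matrix, y : Fin K → ℝ, m̄ : Fin D → ℝ, and τ, β > 0. Set B := τ⁻² • (Aᵀ * A) + β⁻² • 1 (a D×D matrix). Then B is invertible; write M := B⁻¹ and m_post := M.mulVec (τ⁻² • Aᵀ.mulVec y + β⁻² • m̄). Define the RTO output m*(ε₁, ε₂) := M.mulVec (τ⁻² • Aᵀ.mulVec (y + τ • ε₁) + β⁻² • (m̄ + β • ε₂)). If (ε₁, ε₂) is distributed according to the product of standard Gaussians (⨂_{i<K} N(0,1)) ⊗ (⨂_{j<D} N(0,1)), then for every direction u : Fin D → ℝ, the law of the real random variable u ⬝ᵥ m*(ε₁, ε₂) is the Gaussian gaussianReal (u ⬝ᵥ M.mulVec (τ⁻² • Aᵀ.mulVec y + β⁻² • m̄)) (u ⬝ᵥ M.mulVec u). In other words, the RTO output is exactly distributed according to the Gaussian prediction distribution with mean m_post and covariance M = B⁻¹. -/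
open MeasureTheory ProbabilityTheory Matrix

/-- A linear functional of a standard Gaussian vector is a centered real Gaussian. -/
lemma measurePreserving_dotProduct_pi_gaussianReal {ι : Type*} [Fintype ι] (a : ι → ℝ) :
    MeasurePreserving (fun x : ι → ℝ => a ⬝ᵥ x) (Measure.pi fun _ => gaussianReal 0 1)
      (gaussianReal 0 (a ⬝ᵥ a).toNNReal) where
  measurable := by
    unfold dotProduct
    fun_prop
  map_eq := by
    have hcomp : (fun x : ι → ℝ => a ⬝ᵥ x) =
        (innerSL ℝ (WithLp.toLp 2 a) : EuclideanSpace ℝ ι → ℝ) ∘ WithLp.toLp 2 := by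
      ext x
      simp [PiLp.inner_apply, dotProduct, mul_comm]
    have hnorm : ‖(WithLp.toLp 2 a : EuclideanSpace ℝ ι)‖ ^ 2 = a ⬝ᵥ a := by
      rw [EuclideanSpace.real_norm_sq_eq]
      simp [dotProduct, pow_two]
    rw [hcomp, ← Measure.map_map (by fun_prop) (by fun_prop), map_pi_eq_stdGaussian,
      IsGaussian.map_eq_gaussianReal, integral_strongDual_stdGaussian, variance_dual_stdGaussian,
      innerSL_apply_norm, hnorm]

/-- An affine functional of two independent standard Gaussian vectors is a real Gaussian. -/
lemma map_const_add_dotProduct_prod_gaussianReal {ι κ : Type*} [Fintype ι] [Fintype κ]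
    (c : ℝ) (a : ι → ℝ) (b : κ → ℝ) :
    ((Measure.pi fun _ : ι => gaussianReal 0 1).prod
        (Measure.pi fun _ : κ => gaussianReal 0 1)).map
      (fun ε : (ι → ℝ) × (κ → ℝ) => c + (a ⬝ᵥ ε.1 + b ⬝ᵥ ε.2)) =
      gaussianReal c (a ⬝ᵥ a + b ⬝ᵥ b).toNNReal := by
  have ha := measurePreserving_dotProduct_pi_gaussianReal a
  have hb := measurePreserving_dotProduct_pi_gaussianReal b
  have hfst := ha.comp (measurePreserving_fst (ν := Measure.pi fun _ : κ => gaussianReal 0 1))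
  have hsnd := hb.comp (measurePreserving_snd (μ := Measure.pi fun _ : ι => gaussianReal 0 1))
  have hmeas : Measurable ((fun ε : (ι → ℝ) × (κ → ℝ) => a ⬝ᵥ ε.1) + fun ε => b ⬝ᵥ ε.2) :=
    hfst.measurable.add hsnd.measurable
  have hadd := gaussianReal_add_gaussianReal_of_indepFun
    (indepFun_prod ha.measurable hb.measurable) hfst.map_eq hsnd.map_eq
  rw [show (fun ε : (ι → ℝ) × (κ → ℝ) => c + (a ⬝ᵥ ε.1 + b ⬝ᵥ ε.2)) =
      (fun x => c + x) ∘ ((fun ε => a ⬝ᵥ ε.1) + fun ε => b ⬝ᵥ ε.2) from rfl,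
    ← Measure.map_map (by fun_prop) hmeas,
    hadd, gaussianReal_map_const_add,
    Real.toNNReal_add (by simpa using dotProduct_star_self_nonneg a)
      (by simpa using dotProduct_star_self_nonneg b)]
  simp

/-- The precision matrix `s AᵀA + t I` is positive definite. -/
lemma posDef_smul_transpose_mul_self_add_smul_one {ι κ : Type*} [Fintype ι] [Fintype κ]
    [DecidableEq ι] (A : Matrix κ ι ℝ) {s t : ℝ} (hs : 0 ≤ s) (ht : 0 < t) :
    (s • (Aᵀ * A) + t • (1 : Matrix ι ι ℝ)).PosDef := by
  have hA : (Aᵀ * A).PosSemidef := by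
    simpa [conjTranspose_eq_transpose_of_trivial] using posSemidef_conjTranspose_mul_self A
  exact (PosDef.one.smul ht).posSemidef_add (hA.smul hs)

/-- Exactness of randomize-then-optimize (RTO) sampling in the linear-Gaussian case:
the matrix `B = τ⁻² AᵀA + β⁻² I` is invertible, and if `(ε₁, ε₂)` is a pair of independent
standard Gaussian vectors, then every one-dimensional projection `u ⬝ᵥ m*(ε₁, ε₂)` of the
RTO output is distributed as a Gaussian with mean `u ⬝ᵥ m_post` and variance `u ⬝ᵥ B⁻¹ u`,
i.e. the RTO output has exactly the Gaussian prediction distribution `N(m_post, B⁻¹)`. -/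
theorem rto_exact_linear_gaussian (K D : ℕ) (hK : 0 < K) (hD : 0 < D)
    (A : Matrix (Fin K) (Fin D) ℝ) (y : Fin K → ℝ) (mbar : Fin D → ℝ)
    (τ β : ℝ) (hτ : 0 < τ) (hβ : 0 < β)
    (B : Matrix (Fin D) (Fin D) ℝ)
    (hB : B = (τ ^ 2)⁻¹ • (Aᵀ * A) + (β ^ 2)⁻¹ • (1 : Matrix (Fin D) (Fin D) ℝ))
    (M : Matrix (Fin D) (Fin D) ℝ) (hM : M = B⁻¹)
    (mstar : (Fin K → ℝ) → (Fin D → ℝ) → (Fin D → ℝ))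
    (hmstar : mstar = fun ε₁ ε₂ =>
      M.mulVec ((τ ^ 2)⁻¹ • Aᵀ.mulVec (y + τ • ε₁) + (β ^ 2)⁻¹ • (mbar + β • ε₂))) :
    IsUnit B ∧
    ∀ u : Fin D → ℝ,
      ((Measure.pi fun _ : Fin K => gaussianReal 0 1).prod
          (Measure.pi fun _ : Fin D => gaussianReal 0 1)).map
        (fun ε : (Fin K → ℝ) × (Fin D → ℝ) => u ⬝ᵥ mstar ε.1 ε.2)
      = gaussianReal (u ⬝ᵥ M.mulVec ((τ ^ 2)⁻¹ • Aᵀ.mulVec y + (β ^ 2)⁻¹ • mbar))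
          (Real.toNNReal (u ⬝ᵥ M.mulVec u)) := by
  have hpos : B.PosDef :=
    hB ▸ posDef_smul_transpose_mul_self_add_smul_one A (by positivity) (by positivity)
  refine ⟨hpos.isUnit, fun u => ?_⟩
  have hMsymm : Mᵀ = M := by
    simpa [hM, conjTranspose_eq_transpose_of_trivial] using hpos.isHermitian.inv.eq
  have hdot (v : Fin D → ℝ) : u ⬝ᵥ M *ᵥ v = M *ᵥ u ⬝ᵥ v := by
    rw [dotProduct_mulVec, ← mulVec_transpose, hMsymm]
  have hBM : B *ᵥ M *ᵥ u = u := by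
    rw [mulVec_mulVec, hM, mul_nonsing_inv _ ((isUnit_iff_isUnit_det B).1 hpos.isUnit),
      one_mulVec]
  set w := M *ᵥ u
  have hdotA (v : Fin K → ℝ) : w ⬝ᵥ Aᵀ *ᵥ v = A *ᵥ w ⬝ᵥ v := by
    rw [dotProduct_mulVec, vecMul_transpose]
  have hvar : (τ⁻¹ • A *ᵥ w) ⬝ᵥ (τ⁻¹ • A *ᵥ w) + (β⁻¹ • w) ⬝ᵥ (β⁻¹ • w) = u ⬝ᵥ w := by
    rw [dotProduct_comm u w]
    conv_rhs => rw [← hBM, hB, add_mulVec, smul_mulVec, smul_mulVec, one_mulVec,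
      ← mulVec_mulVec, dotProduct_add, dotProduct_smul, dotProduct_smul, hdotA]
    simp only [smul_dotProduct, dotProduct_smul, smul_eq_mul]
    ring
  have hfun : (fun ε : (Fin K → ℝ) × (Fin D → ℝ) => u ⬝ᵥ mstar ε.1 ε.2) = fun ε =>
      u ⬝ᵥ M *ᵥ ((τ ^ 2)⁻¹ • Aᵀ *ᵥ y + (β ^ 2)⁻¹ • mbar) +
        ((τ⁻¹ • A *ᵥ w) ⬝ᵥ ε.1 + (β⁻¹ • w) ⬝ᵥ ε.2) := by
    ext ε
    simp only [hmstar, hdot, mulVec_add, mulVec_smul, smul_add, dotProduct_add, dotProduct_smul,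
      smul_dotProduct, hdotA, smul_eq_mul]
    field_simp
    ring
  rw [hfun, map_const_add_dotProduct_prod_gaussianReal, hvar]
end
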